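/- Let d, N, T ≥ 1, λ > 0, L > 0, α ≥ 0, and let w : Fin N → ℝ be non-negative and non-increasing with w_max = max_i w i. Let θ⋆ ∈ ℝ^d, and for each round t ∈ Fin T and agent n ∈ Fin N let m_{t,n} ∈ ℝ^d with ‖m_{t,n}‖₂ ≤ L. Let n_t ∈ Fin N be the agent chosen at round t, write x_t = m_{t,n_t}, and define M_t = λ I_d + ∑_{s<t} x_s x_sᵀ (so M_t is positive definite). Let θ̂_t ∈ ℝ^d be estimates satisfying the confidence event ‖θ̂_t − θ⋆‖_{M_t} ≤ α for all t ∈ Fin T. Define the true utilities f_t(n) = ⟨m_{t,n}, θ⋆⟩, assumed nonnegative, and the UCB utilities u_t(n) = ⟨m_{t,n}, θ̂_t⟩ + α · ‖m_{t,n}‖_{M_t⁻¹}. Let U_t : Fin N → ℝ be arbitrary cumulative-utility vectors, suppose n_t maximizes n ↦ G_w(update U_t n (U_t n + u_t(n))) and n⋆_t maximizes n ↦ G_w(update U_t n (U_t n + f_t(n))). Then the cumulative regret satisfies ∑_{t=0}^{T−1} [ G_w(update U_t n⋆_t (U_t n⋆_t + f_t(n⋆_t))) − G_w(update U_t n_t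 (U_t n_t + f_t(n_t))) ] ≤ 2 · α · w_max · √T · √( ∑_{t=0}^{T−1} ‖x_t‖²_{M_t⁻¹} ). -/

import Mathlib

open Finset Matrix

/-- The weighted Gini social-evaluation function: `G_w(U) = ∑ i, w i * Φ_i(U)`,
where `Φ_i(U)` is the `(i+1)`-th smallest entry of `U`. -/
noncomputable def gini {N : ℕ} (w U : Fin N → ℝ) : ℝ :=
  ∑ i, w i * U (Tuple.sort U i)

/-- The `M`-weighted norm `‖x‖_M = √(xᵀ M x)`. -/
noncomputable def wnorm {d : ℕ} (M : Matrix (Fin d) (Fin d) ℝ) (x : Fin d → ℝ) : ℝ :=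
  Real.sqrt (x ⬝ᵥ M.mulVec x)

/-- The sorted pairing of antitone weights minimises over all orderings of the utilities. -/
theorem gini_le_sum_perm {N : ℕ} {w : Fin N → ℝ} (hw : Antitone w) (U : Fin N → ℝ)
    (σ : Equiv.Perm (Fin N)) : gini w U ≤ ∑ i, w i * U (σ i) := by
  have hanti : Antivary w (U ∘ Tuple.sort U) := hw.antivary (Tuple.monotone_sort U)
  have h := hanti.sum_mul_le_sum_mul_comp_perm (σ := (Tuple.sort U)⁻¹ * σ)
  simpa [gini, Equiv.Perm.mul_apply] using h

theorem gini_mono {N : ℕ} {w : Fin N → ℝ} (hw : Antitone w) (hw0 : ∀ i, 0 ≤ w i)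
    {U V : Fin N → ℝ} (hUV : U ≤ V) : gini w U ≤ gini w V :=
  (gini_le_sum_perm hw U (Tuple.sort V)).trans
    (Finset.sum_le_sum fun i _ => mul_le_mul_of_nonneg_left (hUV _) (hw0 i))

theorem gini_le_add_mul_sum_sub {N : ℕ} {w : Fin N → ℝ} (hw : Antitone w) {C : ℝ}
    (hC : ∀ i, w i ≤ C) {U V : Fin N → ℝ} (hUV : U ≤ V) :
    gini w V ≤ gini w U + C * ∑ i, (V i - U i) := by
  calc gini w V ≤ ∑ i, w i * V (Tuple.sort U i) := gini_le_sum_perm hw V _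
    _ = gini w U + ∑ i, w i * (V (Tuple.sort U i) - U (Tuple.sort U i)) := by
      simp [gini, mul_sub]
    _ ≤ gini w U + ∑ i, C * (V (Tuple.sort U i) - U (Tuple.sort U i)) := by
      gcongr with i
      · exact sub_nonneg.2 (hUV _)
      · exact hC i
    _ = gini w U + C * ∑ i, (V i - U i) := by
      rw [← Finset.mul_sum, Equiv.sum_comp (Tuple.sort U) fun i => V i - U i]

theorem gini_update_le_add {N : ℕ} {w : Fin N → ℝ} (hw : Antitone w) {C : ℝ}
    (hC : ∀ i, w i ≤ C) (U : Fin N → ℝ) (n : Fin N) {a b : ℝ} (hab : a ≤ b) :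
    gini w (Function.update U n b) ≤ gini w (Function.update U n a) + C * (b - a) := by
  have h := gini_le_add_mul_sum_sub hw hC
    (Function.update_mono (f := U) (i := n) hab)
  rwa [Finset.sum_eq_single n (fun j _ hj => by simp [hj]) (by simp),
    Function.update_self, Function.update_self] at h

/-- Cauchy–Schwarz for the dual pair of norms attached to a positive definite matrix. -/
theorem abs_dotProduct_le_wnorm_inv_mul_wnorm {d : ℕ} {M : Matrix (Fin d) (Fin d) ℝ}
    (hM : M.PosDef) (x y : Fin d → ℝ) : |x ⬝ᵥ y| ≤ wnorm M⁻¹ x * wnorm M y := by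
  have hnn : ∀ z : Fin d → ℝ, 0 ≤ z ⬝ᵥ M *ᵥ z := fun z => by
    simpa using hM.posSemidef.dotProduct_mulVec_nonneg z
  have hinv : 0 ≤ x ⬝ᵥ M⁻¹ *ᵥ x := by
    simpa using hM.inv.posSemidef.dotProduct_mulVec_nonneg x
  have hunit : IsUnit M.det := hM.det_pos.ne'.isUnit
  have hMz : M *ᵥ (M⁻¹ *ᵥ x) = x := by
    rw [Matrix.mulVec_mulVec, Matrix.mul_nonsing_inv _ hunit, Matrix.one_mulVec]
  have hsymm : Mᵀ = M := by simpa using hM.isHermitian.eq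
  have hzy : (M⁻¹ *ᵥ x) ⬝ᵥ M *ᵥ y = x ⬝ᵥ y := by
    rw [Matrix.dotProduct_mulVec, ← Matrix.mulVec_transpose, hsymm, hMz]
  have hdisc := discrim_le_zero (a := y ⬝ᵥ M *ᵥ y) (b := 2 * (x ⬝ᵥ y)) (c := x ⬝ᵥ M⁻¹ *ᵥ x)
    fun s => by
      have h := hnn (M⁻¹ *ᵥ x + s • y)
      simp only [Matrix.mulVec_add, Matrix.mulVec_smul, add_dotProduct, dotProduct_add,
        smul_dotProduct, dotProduct_smul, hMz, hzy, smul_eq_mul,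
        dotProduct_comm (M⁻¹ *ᵥ x) x, dotProduct_comm y x] at h
      linarith
  rw [wnorm, wnorm, ← Real.sqrt_mul hinv]
  apply Real.abs_le_sqrt
  rw [discrim] at hdisc
  linarith

theorem posDef_smul_one_add_sum_vecMulVec {d : ℕ} {ι : Type*} {lam : ℝ} (hlam : 0 < lam)
    (s : Finset ι) (x : ι → Fin d → ℝ) :
    (lam • (1 : Matrix (Fin d) (Fin d) ℝ) + ∑ i ∈ s, Matrix.vecMulVec (x i) (x i)).PosDef := by
  refine (Matrix.PosDef.one.smul hlam).add_posSemidef (Matrix.posSemidef_sum s fun i _ => ?_)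
  simpa using Matrix.posSemidef_vecMulVec_self_star (x i)

theorem stmt_8 (d N T : ℕ) (hd : 1 ≤ d) (hN : 1 ≤ N) (hT : 1 ≤ T)
    (lam L alpha : ℝ) (hlam : 0 < lam) (hL : 0 < L) (halpha : 0 ≤ alpha)
    (w : Fin N → ℝ) (hw_nonneg : ∀ i, 0 ≤ w i) (hw_anti : Antitone w)
    (wmax : ℝ) (hwmax : wmax = Finset.univ.sup' ⟨⟨0, hN⟩, Finset.mem_univ _⟩ w)
    (thetaStar : Fin d → ℝ)
    (m : Fin T → Fin N → Fin d → ℝ)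
    (hm : ∀ t n, Real.sqrt (∑ i, (m t n i) ^ 2) ≤ L)
    (nt : Fin T → Fin N)
    (x : Fin T → Fin d → ℝ) (hx : ∀ t, x t = m t (nt t))
    (M : Fin T → Matrix (Fin d) (Fin d) ℝ)
    (hM : ∀ t, M t = lam • (1 : Matrix (Fin d) (Fin d) ℝ) +
      ∑ s ∈ Finset.univ.filter (fun s => s < t), Matrix.vecMulVec (x s) (x s))
    (thetaHat : Fin T → Fin d → ℝ)
    (hconf : ∀ t, wnorm (M t) (thetaHat t - thetaStar) ≤ alpha)
    (f : Fin T → Fin N → ℝ) (hf : ∀ t n, f t n = m t n ⬝ᵥ thetaStar)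
    (hfpos : ∀ t n, 0 ≤ f t n)
    (u : Fin T → Fin N → ℝ)
    (hu : ∀ t n, u t n = m t n ⬝ᵥ thetaHat t + alpha * wnorm (M t)⁻¹ (m t n))
    (U : Fin T → Fin N → ℝ)
    (nstar : Fin T → Fin N)
    (hnt : ∀ t n, gini w (Function.update (U t) n (U t n + u t n)) ≤
      gini w (Function.update (U t) (nt t) (U t (nt t) + u t (nt t))))
    (hstar : ∀ t n, gini w (Function.update (U t) n (U t n + f t n)) ≤
      gini w (Function.update (U t) (nstar t) (U t (nstar t) + f t (nstar t)))) :
    ∑ t, (gini w (Function.update (U t) (nstar t) (U t (nstar t) + f t (nstar t))) -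
        gini w (Function.update (U t) (nt t) (U t (nt t) + f t (nt t)))) ≤
      2 * alpha * wmax * Real.sqrt T * Real.sqrt (∑ t, (wnorm (M t)⁻¹ (x t)) ^ 2) := by
  have hC : ∀ i, w i ≤ wmax := fun i => hwmax ▸ Finset.le_sup' w (Finset.mem_univ i)
  have hC0 : 0 ≤ wmax := (hw_nonneg ⟨0, hN⟩).trans (hC _)
  have hconf' : ∀ t n, |m t n ⬝ᵥ thetaHat t - f t n| ≤ alpha * wnorm (M t)⁻¹ (m t n) := by
    intro t n
    have hpos : (M t).PosDef := hM t ▸ posDef_smul_one_add_sum_vecMulVec hlam _ x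
    rw [hf, ← dotProduct_sub, mul_comm]
    exact (abs_dotProduct_le_wnorm_inv_mul_wnorm hpos _ _).trans
      (mul_le_mul_of_nonneg_left (hconf t) (Real.sqrt_nonneg _))
  have hfu : ∀ t n, f t n ≤ u t n := fun t n => by
    linarith [(abs_le.1 (hconf' t n)).1, hu t n]
  have huf : ∀ t n, u t n - f t n ≤ 2 * alpha * wnorm (M t)⁻¹ (m t n) := fun t n => by
    linarith [(abs_le.1 (hconf' t n)).2, hu t n]
  have hround : ∀ t, gini w (Function.update (U t) (nstar t) (U t (nstar t) + f t (nstar t))) -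
      gini w (Function.update (U t) (nt t) (U t (nt t) + f t (nt t))) ≤
      2 * alpha * wmax * wnorm (M t)⁻¹ (x t) := by
    intro t
    have hopt := gini_mono hw_anti hw_nonneg
      (Function.update_mono (f := U t) (i := nstar t)
        (add_le_add_right (hfu t (nstar t)) (U t (nstar t))))
    have hlip := gini_update_le_add hw_anti hC (U t) (nt t)
      (add_le_add_right (hfu t (nt t)) (U t (nt t)))
    have hwidth := mul_le_mul_of_nonneg_left (huf t (nt t)) hC0
    rw [hx]
    linarith [hnt t (nstar t)]
  have hcs : ∑ t, wnorm (M t)⁻¹ (x t) ≤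
      Real.sqrt T * Real.sqrt (∑ t, (wnorm (M t)⁻¹ (x t)) ^ 2) := by
    rw [← Real.sqrt_mul (Nat.cast_nonneg T)]
    apply Real.le_sqrt_of_sq_le
    simpa using sq_sum_le_card_mul_sum_sq (s := Finset.univ) (f := fun t => wnorm (M t)⁻¹ (x t))
  calc _ ≤ ∑ t, 2 * alpha * wmax * wnorm (M t)⁻¹ (x t) := Finset.sum_le_sum fun t _ => hround t
    _ = 2 * alpha * wmax * ∑ t, wnorm (M t)⁻¹ (x t) := by rw [Finset.mul_sum]
    _ ≤ 2 * alpha * wmax * (Real.sqrt T * Real.sqrt (∑ t, (wnorm (M t)⁻¹ (x t)) ^ 2)) :=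
      mul_le_mul_of_nonneg_left hcs (by positivity)
    _ = _ := by ring
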